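/- Let r > 0, L > 0, and 0 < α < 1/(2 log 2). Then there exist constants C > 0 and ε₀ ∈ (0,1) (depending only on r, L, α) such that for every ε ∈ (0, ε₀), setting N = ⌊α log(1/ε)⌋, one has for every real sequence (θ_k)_{k≥0} with Σ_{k=1}^{∞} k^{2r} θ_k² ≤ L: ε² · Σ_{k=0}^{N} σ_k² + Σ_{k=N+1}^{∞} θ_k² ≤ C · (log(1/ε))^{−2r}, where σ_k² = ((2k+1)/2) · 4^{−k} · Σ_{j=0}^{⌊k/2⌋} (C(k,j) · C(2k−2j, k))². -/

import Mathlib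

open Finset

/-- `σ_k²`, the sum of the squared coefficients of the normalized Legendre polynomial of
degree `k`: `σ_k² = ((2k+1)/2) · 4^(−k) · Σ_{j=0}^{⌊k/2⌋} (C(k,j) · C(2k−2j, k))²`. -/
noncomputable def sigmaSq (k : ℕ) : ℝ :=
  ((2 * k + 1 : ℝ) / 2) / 4 ^ k *
    ∑ j ∈ Finset.range (k / 2 + 1),
      ((k.choose j : ℝ) * ((2 * k - 2 * j).choose k : ℝ)) ^ 2

/-- The crude exponential bound `σ_k² ≤ (k+1)² 16^k`. -/
lemma sigmaSq_le (k : ℕ) : sigmaSq k ≤ ((k : ℝ) + 1) ^ 2 * 16 ^ k := by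
  have hterm : ∀ j ∈ Finset.range (k / 2 + 1),
      ((k.choose j : ℝ) * ((2 * k - 2 * j).choose k : ℝ)) ^ 2 ≤ 64 ^ k := by
    intro j _
    have h1 : (k.choose j : ℝ) ≤ 2 ^ k := by exact_mod_cast Nat.choose_le_two_pow k j
    have h2 : ((2 * k - 2 * j).choose k : ℝ) ≤ 4 ^ k := by
      have : (2 * k - 2 * j).choose k ≤ 4 ^ k :=
        calc (2 * k - 2 * j).choose k ≤ 2 ^ (2 * k - 2 * j) := Nat.choose_le_two_pow _ _
          _ ≤ 2 ^ (2 * k) := Nat.pow_le_pow_right (by norm_num) (Nat.sub_le _ _)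
          _ = 4 ^ k := by rw [pow_mul]; norm_num
      exact_mod_cast this
    calc ((k.choose j : ℝ) * ((2 * k - 2 * j).choose k : ℝ)) ^ 2
        ≤ ((2 : ℝ) ^ k * 4 ^ k) ^ 2 := by gcongr
      _ = 64 ^ k := by rw [← mul_pow, ← pow_mul, mul_comm k 2, pow_mul]; norm_num
  have hsum := Finset.sum_le_card_nsmul _ _ _ hterm
  rw [Finset.card_range, nsmul_eq_mul] at hsum
  have hcard : ((k / 2 + 1 : ℕ) : ℝ) ≤ k + 1 := by
    exact_mod_cast Nat.succ_le_succ (Nat.div_le_self k 2)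
  have h64 : (64 : ℝ) ^ k = 4 ^ k * 16 ^ k := by rw [← mul_pow]; norm_num
  calc sigmaSq k
      ≤ ((2 * k + 1 : ℝ) / 2) / 4 ^ k * (((k / 2 + 1 : ℕ) : ℝ) * 64 ^ k) := by
        unfold sigmaSq; gcongr
    _ = ((2 * k + 1 : ℝ) / 2) * ((k / 2 + 1 : ℕ) : ℝ) * 16 ^ k := by
        rw [h64]; field_simp
    _ ≤ ((k : ℝ) + 1) * (k + 1) * 16 ^ k := by
        gcongr; linarith
    _ = ((k : ℝ) + 1) ^ 2 * 16 ^ k := by ring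

lemma sum_sigmaSq_le (N : ℕ) :
    ∑ k ∈ Finset.range (N + 1), sigmaSq k ≤ ((N : ℝ) + 1) ^ 3 * 16 ^ N := by
  have h : ∀ k ∈ Finset.range (N + 1), sigmaSq k ≤ ((N : ℝ) + 1) ^ 2 * 16 ^ N := by
    intro k hk
    have hkN : k ≤ N := Nat.lt_succ_iff.mp (Finset.mem_range.mp hk)
    refine (sigmaSq_le k).trans ?_
    gcongr
    norm_num
  have hsum := Finset.sum_le_card_nsmul _ _ _ h
  rw [Finset.card_range, nsmul_eq_mul] at hsum
  push_cast at hsum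
  linarith

/-- The variance term with cutoff `⌊αx⌋` at noise level `ε = e^(-x)`. -/
lemma exp_mul_sum_sigmaSq_le {α x : ℝ} (hα : 0 < α) (hx : 0 < x) :
    Real.exp (-x) ^ 2 * ∑ k ∈ Finset.range (⌊α * x⌋₊ + 1), sigmaSq k ≤
      (α * x + 1) ^ 3 * Real.exp (-(2 - 4 * α * Real.log 2) * x) := by
  have hN : (⌊α * x⌋₊ : ℝ) ≤ α * x := Nat.floor_le (by positivity)
  have hlog : Real.log 16 = 4 * Real.log 2 := by
    rw [show (16 : ℝ) = 2 ^ 4 by norm_num, Real.log_pow]; norm_num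
  have h16 : (16 : ℝ) ^ ⌊α * x⌋₊ ≤ Real.exp (4 * Real.log 2 * (α * x)) := by
    rw [← Real.rpow_natCast, Real.rpow_def_of_pos (by norm_num), hlog]
    have := Real.log_pos (by norm_num : (1 : ℝ) < 2)
    gcongr
  calc Real.exp (-x) ^ 2 * ∑ k ∈ Finset.range (⌊α * x⌋₊ + 1), sigmaSq k
      ≤ Real.exp (-x) ^ 2 * ((α * x + 1) ^ 3 * Real.exp (4 * Real.log 2 * (α * x))) := by
        gcongr
        exact (sum_sigmaSq_le _).trans (by gcongr)
    _ = (α * x + 1) ^ 3 * Real.exp (-(2 - 4 * α * Real.log 2) * x) := by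
        rw [← Real.exp_nat_mul, mul_left_comm, ← Real.exp_add]
        congr 2
        push_cast
        ring

open Filter Topology in
/-- Exponential decay beats the cubic and power factors. -/
lemma eventually_cubic_mul_exp_le_rpow (α s : ℝ) {δ : ℝ} (hδ : 0 < δ) :
    ∀ᶠ x : ℝ in atTop, (α * x + 1) ^ 3 * Real.exp (-δ * x) ≤ x ^ (-s) := by
  have hlim : Tendsto (fun x : ℝ => (α + x⁻¹) ^ 3 * (x ^ (s + 3) * Real.exp (-δ * x)))
      atTop (𝓝 ((α + 0) ^ 3 * 0)) :=
    ((tendsto_const_nhds.add tendsto_inv_atTop_zero).pow 3).mul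
      (tendsto_rpow_mul_exp_neg_mul_atTop_nhds_zero _ _ hδ)
  rw [mul_zero] at hlim
  filter_upwards [hlim.eventually_le_const zero_lt_one, eventually_gt_atTop 0] with x h hx
  have hs : 0 < x ^ s := Real.rpow_pos_of_pos hx s
  rw [Real.rpow_neg hx.le, ← one_div, le_div_iff₀ hs]
  refine le_trans (le_of_eq ?_) h
  rw [Real.rpow_add hx, show (3 : ℝ) = (3 : ℕ) by norm_num, Real.rpow_natCast]
  field_simp

/-- The tail of a sequence in a Sobolev ball beyond the cutoff `⌊y⌋`. -/
lemma tsum_tail_sq_le {s L y : ℝ} (hs : 0 < s) (hy : 0 < y) {θ : ℕ → ℝ}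
    (hsum : Summable fun k : ℕ => (k : ℝ) ^ s * θ k ^ 2)
    (hle : ∑' k : ℕ, (k : ℝ) ^ s * θ k ^ 2 ≤ L) :
    ∑' k : ℕ, θ (k + ⌊y⌋₊ + 1) ^ 2 ≤ L * y ^ (-s) := by
  have hys : 0 < y ^ s := Real.rpow_pos_of_pos hy s
  have hinj : Function.Injective fun k : ℕ => k + ⌊y⌋₊ + 1 := fun a b h => by
    simpa using h
  have hbound : ∀ k : ℕ, θ (k + ⌊y⌋₊ + 1) ^ 2 ≤
      y ^ (-s) * (((k + ⌊y⌋₊ + 1 : ℕ) : ℝ) ^ s * θ (k + ⌊y⌋₊ + 1) ^ 2) := by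
    intro k
    have hk : y ≤ ((k + ⌊y⌋₊ + 1 : ℕ) : ℝ) := by
      have := Nat.lt_floor_add_one y
      push_cast
      linarith [Nat.cast_nonneg (α := ℝ) k]
    rw [Real.rpow_neg hy.le, ← mul_assoc]
    refine le_mul_of_one_le_left (sq_nonneg _) ?_
    rw [inv_mul_eq_div, one_le_div hys]
    exact Real.rpow_le_rpow hy.le hk hs.le
  have hshift := hsum.comp_injective hinj
  have hmaj := hshift.mul_left (y ^ (-s))
  calc ∑' k : ℕ, θ (k + ⌊y⌋₊ + 1) ^ 2
      ≤ ∑' k : ℕ, y ^ (-s) * (((k + ⌊y⌋₊ + 1 : ℕ) : ℝ) ^ s * θ (k + ⌊y⌋₊ + 1) ^ 2) :=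
        (Summable.of_nonneg_of_le (fun _ => sq_nonneg _) hbound hmaj).tsum_le_tsum hbound hmaj
    _ = y ^ (-s) * ∑' k : ℕ, ((k + ⌊y⌋₊ + 1 : ℕ) : ℝ) ^ s * θ (k + ⌊y⌋₊ + 1) ^ 2 :=
        tsum_mul_left
    _ ≤ y ^ (-s) * L := by
        gcongr
        exact (tsum_comp_le_tsum_of_inj hsum (fun _ => by positivity) hinj).trans hle
    _ = L * y ^ (-s) := mul_comm _ _

/-- Deterministic form of the upper bound: for `r > 0`, `L > 0`, `0 < α < 1/(2 log 2)` there
are `C > 0` and `ε₀ ∈ (0,1)` such that for all `ε ∈ (0, ε₀)`, with `N = ⌊α log(1/ε)⌋`, every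
sequence `(θ_k)` with `Σ_{k≥1} k^(2r) θ_k² ≤ L` satisfies
`ε² Σ_{k=0}^N σ_k² + Σ_{k>N} θ_k² ≤ C (log(1/ε))^(−2r)`. -/
theorem upper_bound_deterministic (r L α : ℝ) (hr : 0 < r) (hL : 0 < L)
    (hα : 0 < α) (hα' : α < 1 / (2 * Real.log 2)) :
    ∃ C : ℝ, 0 < C ∧ ∃ ε₀ ∈ Set.Ioo (0 : ℝ) 1, ∀ ε ∈ Set.Ioo (0 : ℝ) ε₀,
      ∀ θ : ℕ → ℝ, (Summable fun k : ℕ => (k : ℝ) ^ (2 * r) * θ k ^ 2) →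
        (∑' k : ℕ, (k : ℝ) ^ (2 * r) * θ k ^ 2 ≤ L) →
        ε ^ 2 * ∑ k ∈ Finset.range (⌊α * Real.log (1 / ε)⌋₊ + 1), sigmaSq k +
            ∑' k : ℕ, θ (k + ⌊α * Real.log (1 / ε)⌋₊ + 1) ^ 2 ≤
          C * Real.log (1 / ε) ^ (-(2 * r)) := by
  have hlog2 : 0 < Real.log 2 := Real.log_pos (by norm_num)
  have hδ : 0 < 2 - 4 * α * Real.log 2 := by
    rw [lt_div_iff₀ (by positivity)] at hα'
    linarith
  obtain ⟨X, hX⟩ := Filter.eventually_atTop.mp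
    (eventually_cubic_mul_exp_le_rpow α (2 * r) hδ)
  refine ⟨1 + L * α ^ (-(2 * r)), by positivity, Real.exp (-max X 1),
    ⟨Real.exp_pos _, Real.exp_lt_one_iff.mpr (by linarith [le_max_right X 1])⟩, ?_⟩
  rintro ε ⟨hε, hε'⟩ θ hsum hle
  obtain ⟨x, rfl⟩ : ∃ x, ε = Real.exp (-x) := ⟨-Real.log ε, by simp [Real.exp_log hε]⟩
  have hmax : max X 1 < x := by linarith [Real.exp_lt_exp.mp hε']
  have hx : 0 < x := by linarith [le_max_right X 1]
  have hinv : Real.log (1 / Real.exp (-x)) = x := by simp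
  rw [hinv]
  have hbias := tsum_tail_sq_le (by positivity) (mul_pos hα hx) hsum hle
  rw [Real.mul_rpow hα.le hx.le] at hbias
  have hvar := (exp_mul_sum_sigmaSq_le hα hx).trans
    (hX x ((le_max_left X 1).trans hmax.le))
  linarith
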